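/- Let H be a complex Hilbert space, G a group, ρ : G →* (H ≃ₗᵢ[ℂ] H) a unitary representation, S a nonempty finite subset of G generating G as a group (the subgroup generated by S is all of G), F := { h ∈ H | ρ(g) h = h for all g ∈ G }, and M_S := (1/|S|) ∑_{s∈S} ρ(s) the Markov operator. Then for h ∈ H one has M_S h = h if and only if h ∈ F; i.e. the 1-eigenspace of M_S is exactly the space of G-invariant vectors. -/

import Mathlib

/-- If `S` is a finite nonempty generating set of `G`, then the `1`-eigenspace
of the Markov operator `M_S = (1/|S|) ∑_{s∈S} ρ(s)` of a unitary representation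
`ρ` is exactly the space of `G`-invariant vectors. -/
theorem markov_fixed_iff_invariant
    {H : Type*} [NormedAddCommGroup H] [InnerProductSpace ℂ H] [CompleteSpace H]
    {G : Type*} [Group G] (ρ : G →* (H ≃ₗᵢ[ℂ] H))
    (S : Finset G) (hS : S.Nonempty)
    (hgen : Subgroup.closure (S : Set G) = ⊤) :
    ∀ h : H, ((S.card : ℂ)⁻¹ • ∑ s ∈ S, ρ s h) = h ↔ ∀ g : G, ρ g h = h := by
  intro h
  have hn : (S.card : ℂ) ≠ 0 := by
    exact_mod_cast hS.card_pos.ne'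
  constructor
  · intro hM
    have hsum : ∑ s ∈ S, ρ s h = (S.card : ℂ) • h := by
      rw [inv_smul_eq_iff₀ hn] at hM
      exact hM
    have hre : ∑ s ∈ S, (inner ℂ h (ρ s h)).re = S.card * ‖h‖ ^ 2 := by
      rw [← Complex.re_sum, ← inner_sum, hsum, inner_smul_right,
        inner_self_eq_norm_sq_to_K]
      simp [← Complex.ofReal_pow]
    have hz : ∑ s ∈ S, ‖h - ρ s h‖ ^ 2 = 0 := by
      have h1 : ∀ s ∈ S, ‖h - ρ s h‖ ^ 2 =
          2 * ‖h‖ ^ 2 - 2 * (inner ℂ h (ρ s h)).re := by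
        intro s _
        rw [@norm_sub_sq ℂ, LinearIsometryEquiv.norm_map]
        simp only [RCLike.re_to_complex]
        ring
      rw [Finset.sum_congr rfl h1, Finset.sum_sub_distrib, ← Finset.mul_sum, ← Finset.mul_sum,
        hre, Finset.sum_const, nsmul_eq_mul]
      ring
    rw [Finset.sum_eq_zero_iff_of_nonneg (fun _ _ => by positivity)] at hz
    have hfix : ∀ s ∈ S, ρ s h = h := by
      intro s hs
      have h2 := hz s hs
      rw [sq_eq_zero_iff, norm_eq_zero, sub_eq_zero] at h2
      exact h2.symm
    intro g
    have hg : g ∈ Subgroup.closure (S : Set G) := by rw [hgen]; trivial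
    induction hg using Subgroup.closure_induction with
    | mem x hx => exact hfix x hx
    | one => simp
    | mul x y _ _ hx hy =>
      rw [map_mul]
      change ρ x (ρ y h) = h
      rw [hy, hx]
    | inv x _ hx =>
      have h3 : ρ x⁻¹ (ρ x h) = h := by
        change (ρ x⁻¹ * ρ x) h = h
        rw [← map_mul]
        simp
      rwa [hx] at h3
  · intro hF
    rw [inv_smul_eq_iff₀ hn, Finset.sum_congr rfl (fun s _ => hF s), Finset.sum_const,
      Nat.cast_smul_eq_nsmul]
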